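/- Fix an integer p ≥ 1 and define F(Δ) = (I_p + Δ Δᵀ)⁻¹ Δ for real p×p matrices Δ. Then F is globally Lipschitz in the Frobenius norm with constant 5/4: for all real p×p matrices Δ₁ and Δ₂, ‖F(Δ₁) − F(Δ₂)‖_F ≤ (5/4)·‖Δ₁ − Δ₂‖_F. Consequently, the vector obtained by stacking two copies of F(Δ₁) − F(Δ₂) has Euclidean norm at most (10/4)·‖Δ₁ − Δ₂‖_F. -/

import Mathlib

open Matrix

/-- The Frobenius norm of a real matrix: the square root of the sum of squared entries. -/
noncomputable def frobNorm {p : ℕ} (M : Matrix (Fin p) (Fin p) ℝ) : ℝ :=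
  Real.sqrt (∑ i, ∑ j, (M i j) ^ 2)

theorem frobNorm_sq {p : ℕ} (M : Matrix (Fin p) (Fin p) ℝ) :
    frobNorm M ^ 2 = (Mᵀ * M).trace := by
  rw [frobNorm, Real.sq_sqrt (by positivity), Finset.sum_comm]
  simp [Matrix.trace, Matrix.mul_apply, sq]

theorem frobNorm_nonneg {p : ℕ} (M : Matrix (Fin p) (Fin p) ℝ) : 0 ≤ frobNorm M :=
  Real.sqrt_nonneg _

theorem frobNorm_transpose {p : ℕ} (M : Matrix (Fin p) (Fin p) ℝ) :
    frobNorm Mᵀ = frobNorm M := by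
  simp only [frobNorm, transpose_apply]
  rw [Finset.sum_comm]

section

attribute [local instance] Matrix.frobeniusNormedAddCommGroup

theorem frobNorm_eq_norm {p : ℕ} (M : Matrix (Fin p) (Fin p) ℝ) : frobNorm M = ‖M‖ := by
  simp [frobNorm, Matrix.frobenius_norm_def, Real.sqrt_eq_rpow]

theorem frobNorm_sub_le {p : ℕ} (M N : Matrix (Fin p) (Fin p) ℝ) :
    frobNorm (M - N) ≤ frobNorm M + frobNorm N := by
  simpa only [frobNorm_eq_norm] using norm_sub_le M N

end

theorem isUnit_det_one_add_mul_transpose {p : ℕ} (X : Matrix (Fin p) (Fin p) ℝ) :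
    IsUnit (1 + X * Xᵀ).det := by
  have h := Matrix.PosDef.one.add_posSemidef (Matrix.posSemidef_self_mul_conjTranspose X)
  rw [conjTranspose_eq_transpose_of_trivial] at h
  exact h.det_pos.ne'.isUnit

/-- Two expansions of the squared norm of `N + X Xᵀ N`. -/
theorem frobNorm_sq_one_add_mul {p : ℕ} (X N : Matrix (Fin p) (Fin p) ℝ) :
    frobNorm ((1 + X * Xᵀ) * N) ^ 2 =
        frobNorm N ^ 2 + 2 * frobNorm (Xᵀ * N) ^ 2 + frobNorm (X * Xᵀ * N) ^ 2 ∧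
      frobNorm ((1 + X * Xᵀ) * N) ^ 2 =
        frobNorm (N - X * Xᵀ * N) ^ 2 + 4 * frobNorm (Xᵀ * N) ^ 2 := by
  simp only [frobNorm_sq, transpose_mul, transpose_add, transpose_sub,
    transpose_transpose, Matrix.add_mul, Matrix.mul_add, Matrix.sub_mul, Matrix.mul_sub,
    Matrix.one_mul, Matrix.mul_assoc, trace_add, trace_sub]
  constructor <;> ring

theorem frobNorm_inv_mul_le {p : ℕ} (X M : Matrix (Fin p) (Fin p) ℝ) :
    frobNorm ((1 + X * Xᵀ)⁻¹ * M) ≤ frobNorm M := by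
  have h := (frobNorm_sq_one_add_mul X ((1 + X * Xᵀ)⁻¹ * M)).1
  rw [Matrix.mul_nonsing_inv_cancel_left _ _ (isUnit_det_one_add_mul_transpose X)] at h
  refine le_of_sq_le_sq ?_ (frobNorm_nonneg M)
  rw [h]
  nlinarith [sq_nonneg (frobNorm (Xᵀ * ((1 + X * Xᵀ)⁻¹ * M))),
    sq_nonneg (frobNorm (X * Xᵀ * ((1 + X * Xᵀ)⁻¹ * M)))]

theorem two_mul_frobNorm_transpose_mul_inv_mul_le {p : ℕ} (X M : Matrix (Fin p) (Fin p) ℝ) :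
    2 * frobNorm (Xᵀ * ((1 + X * Xᵀ)⁻¹ * M)) ≤ frobNorm M := by
  have h := (frobNorm_sq_one_add_mul X ((1 + X * Xᵀ)⁻¹ * M)).2
  rw [Matrix.mul_nonsing_inv_cancel_left _ _ (isUnit_det_one_add_mul_transpose X)] at h
  refine le_of_sq_le_sq ?_ (frobNorm_nonneg M)
  rw [h, mul_pow]
  nlinarith [sq_nonneg (frobNorm ((1 + X * Xᵀ)⁻¹ * M - X * Xᵀ * ((1 + X * Xᵀ)⁻¹ * M)))]

theorem inv_mul_eq_mul_inv {p : ℕ} (X : Matrix (Fin p) (Fin p) ℝ) :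
    (1 + X * Xᵀ)⁻¹ * X = X * (1 + Xᵀ * X)⁻¹ := by
  have hA := isUnit_det_one_add_mul_transpose X
  have hB := isUnit_det_one_add_mul_transpose Xᵀ
  rw [transpose_transpose] at hB
  have h : X * (1 + Xᵀ * X) = (1 + X * Xᵀ) * X := by noncomm_ring
  calc (1 + X * Xᵀ)⁻¹ * X = (1 + X * Xᵀ)⁻¹ * (X * (1 + Xᵀ * X)) * (1 + Xᵀ * X)⁻¹ := by
        rw [← Matrix.mul_assoc, Matrix.mul_nonsing_inv_cancel_right _ _ hB]
    _ = X * (1 + Xᵀ * X)⁻¹ := by rw [h, Matrix.nonsing_inv_mul_cancel_left _ _ hA]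

theorem inv_mul_sub_inv_mul {p : ℕ} (X Y : Matrix (Fin p) (Fin p) ℝ) :
    (1 + X * Xᵀ)⁻¹ * X - (1 + Y * Yᵀ)⁻¹ * Y =
      (1 + X * Xᵀ)⁻¹ * ((X - Y) * (1 + Yᵀ * Y)⁻¹) -
        (1 + X * Xᵀ)⁻¹ * X * ((X - Y)ᵀ * (Y * (1 + Yᵀ * Y)⁻¹)) := by
  have hA := isUnit_det_one_add_mul_transpose X
  have hB := isUnit_det_one_add_mul_transpose Yᵀ
  rw [transpose_transpose] at hB
  rw [inv_mul_eq_mul_inv Y]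
  have hl : (1 + X * Xᵀ)⁻¹ * X = (1 + X * Xᵀ)⁻¹ * (X * (1 + Yᵀ * Y)) * (1 + Yᵀ * Y)⁻¹ := by
    rw [← Matrix.mul_assoc, Matrix.mul_nonsing_inv_cancel_right _ _ hB]
  have hr : Y * (1 + Yᵀ * Y)⁻¹ = (1 + X * Xᵀ)⁻¹ * ((1 + X * Xᵀ) * Y) * (1 + Yᵀ * Y)⁻¹ := by
    rw [Matrix.nonsing_inv_mul_cancel_left _ _ hA]
  calc _ = (1 + X * Xᵀ)⁻¹ * (X * (1 + Yᵀ * Y)) * (1 + Yᵀ * Y)⁻¹ -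
        (1 + X * Xᵀ)⁻¹ * ((1 + X * Xᵀ) * Y) * (1 + Yᵀ * Y)⁻¹ := by rw [← hl, ← hr]
    _ = _ := by
      rw [transpose_sub]
      generalize (1 + X * Xᵀ)⁻¹ = A
      generalize (1 + Yᵀ * Y)⁻¹ = B
      noncomm_ring

theorem frobNorm_inv_mul_sub_inv_mul_le {p : ℕ} (X Y : Matrix (Fin p) (Fin p) ℝ) :
    frobNorm ((1 + X * Xᵀ)⁻¹ * X - (1 + Y * Yᵀ)⁻¹ * Y) ≤ 5 / 4 * frobNorm (X - Y) := by
  have h₁ : frobNorm ((1 + X * Xᵀ)⁻¹ * ((X - Y) * (1 + Yᵀ * Y)⁻¹)) ≤ frobNorm (X - Y) := by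
    refine (frobNorm_inv_mul_le X _).trans ?_
    have h := frobNorm_inv_mul_le Yᵀ (X - Y)ᵀ
    rw [← frobNorm_transpose] at h
    simpa [transpose_nonsing_inv, frobNorm_transpose, ← transpose_sub] using h
  have h₂ : 2 * frobNorm ((1 + X * Xᵀ)⁻¹ * X * ((X - Y)ᵀ * (Y * (1 + Yᵀ * Y)⁻¹))) ≤
      frobNorm ((X - Y)ᵀ * (Y * (1 + Yᵀ * Y)⁻¹)) := by
    rw [inv_mul_eq_mul_inv, Matrix.mul_assoc]
    simpa using two_mul_frobNorm_transpose_mul_inv_mul_le Xᵀ ((X - Y)ᵀ * (Y * (1 + Yᵀ * Y)⁻¹))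
  have h₃ : 2 * frobNorm ((X - Y)ᵀ * (Y * (1 + Yᵀ * Y)⁻¹)) ≤ frobNorm (X - Y) := by
    have h := two_mul_frobNorm_transpose_mul_inv_mul_le Y (X - Y)
    rw [← inv_mul_eq_mul_inv, ← frobNorm_transpose]
    simpa [transpose_nonsing_inv, Matrix.mul_assoc] using h
  rw [inv_mul_sub_inv_mul]
  linarith [frobNorm_sub_le ((1 + X * Xᵀ)⁻¹ * ((X - Y) * (1 + Yᵀ * Y)⁻¹))
    ((1 + X * Xᵀ)⁻¹ * X * ((X - Y)ᵀ * (Y * (1 + Yᵀ * Y)⁻¹)))]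

/-- Fix `p ≥ 1` and define `F(Δ) = (I_p + Δ Δᵀ)⁻¹ Δ` for real `p × p`
matrices. Then `F` is globally Lipschitz in the Frobenius norm with constant `5/4`:
`‖F(Δ₁) − F(Δ₂)‖_F ≤ (5/4)·‖Δ₁ − Δ₂‖_F` for all `Δ₁, Δ₂`. Consequently, the vector
obtained by stacking two copies of `F(Δ₁) − F(Δ₂)` (whose Euclidean norm is
`√(‖F(Δ₁) − F(Δ₂)‖_F² + ‖F(Δ₁) − F(Δ₂)‖_F²)`) has Euclidean norm at most
`(10/4)·‖Δ₁ − Δ₂‖_F`. -/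
theorem gradient_lipschitz_frobenius (p : ℕ) (hp : 1 ≤ p)
    (Δ₁ Δ₂ : Matrix (Fin p) (Fin p) ℝ) :
    frobNorm ((1 + Δ₁ * Δ₁ᵀ)⁻¹ * Δ₁ - (1 + Δ₂ * Δ₂ᵀ)⁻¹ * Δ₂)
      ≤ (5 / 4) * frobNorm (Δ₁ - Δ₂)
    ∧ Real.sqrt
        (frobNorm ((1 + Δ₁ * Δ₁ᵀ)⁻¹ * Δ₁ - (1 + Δ₂ * Δ₂ᵀ)⁻¹ * Δ₂) ^ 2 +
          frobNorm ((1 + Δ₁ * Δ₁ᵀ)⁻¹ * Δ₁ - (1 + Δ₂ * Δ₂ᵀ)⁻¹ * Δ₂) ^ 2)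
      ≤ (10 / 4) * frobNorm (Δ₁ - Δ₂) := by
  have h := frobNorm_inv_mul_sub_inv_mul_le Δ₁ Δ₂
  refine ⟨h, Real.sqrt_le_iff.mpr ⟨by linarith [frobNorm_nonneg (Δ₁ - Δ₂)], ?_⟩⟩
  nlinarith [frobNorm_nonneg ((1 + Δ₁ * Δ₁ᵀ)⁻¹ * Δ₁ - (1 + Δ₂ * Δ₂ᵀ)⁻¹ * Δ₂),
    frobNorm_nonneg (Δ₁ - Δ₂)]
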